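/- arXiv:cond-mat/9807232 — 11 statements merged into one kernel-verified Lean document; each statement's English description precedes it below -/
import Mathlib

section
/- Fix integers L ≥ 2 and 1 ≤ N ≤ L−1 and a real number u. Then for every real λ, det(H₀ − λ·I) = (λ₂ − λ)^{N−1} · (λ₁ − λ)^{L−N−1} · (λ₊ − λ) · (λ₋ − λ), where λ₁ = 1/L, λ₂ = 1/L + u, and λ± = 1/L + (u − 1 ± Δ(N/L))/2 with Δ(ρ) = √((u+1)² − 4uρ). In particular the spectrum of H₀ is {λ₁, λ₂, λ₊, λ₋} with multiplicities L−N−1, N−1, 1, 1. -/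
theorem aux_prod (L N : ℕ) (h : N ≤ L) (a b : ℝ) :
    ∏ x : Fin L, (if (x : ℕ) < N then a else b) = a ^ N * b ^ (L - N) := by
  obtain ⟨k, rfl⟩ := Nat.exists_eq_add_of_le h
  rw [Fin.prod_univ_add]
  simp

theorem aux_sum (L N : ℕ) (h : N ≤ L) (a b : ℝ) :
    ∑ x : Fin L, (if (x : ℕ) < N then a else b) = N * a + ((L : ℝ) - N) * b := by
  obtain ⟨k, rfl⟩ := Nat.exists_eq_add_of_le h
  rw [Fin.sum_univ_add]
  simp

theorem aux_det (L N : ℕ) (h : N ≤ L) (a b c : ℝ) (ha : a ≠ 0) (hb : b ≠ 0) :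
    (Matrix.of (fun x y : Fin L =>
      (if x = y then (if (x : ℕ) < N then a else b) else 0) + c)).det
    = a ^ N * b ^ (L - N) * (1 + (N * (c / a) + ((L : ℝ) - N) * (c / b))) := by
  have e : (Matrix.of (fun x y : Fin L =>
      (if x = y then (if (x : ℕ) < N then a else b) else 0) + c))
      = Matrix.diagonal (fun x : Fin L => if (x : ℕ) < N then a else b) *
        (1 + Matrix.replicateCol Unit (fun x : Fin L => if (x : ℕ) < N then c / a else c / b) *
          Matrix.replicateRow Unit (fun _ : Fin L => (1 : ℝ))) := by
    ext x y
    rw [Matrix.diagonal_mul]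
    simp only [Matrix.of_apply, Matrix.add_apply, Matrix.mul_apply, Matrix.one_apply,
      Matrix.replicateCol_apply, Matrix.replicateRow_apply, Finset.univ_unique,
      Finset.sum_singleton]
    split_ifs <;> field_simp <;> ring
  rw [e, Matrix.det_mul, Matrix.det_diagonal, aux_prod L N h,
    Matrix.det_one_add_replicateCol_mul_replicateRow]
  simp only [dotProduct, one_mul]
  rw [aux_sum L N h]

theorem aux_main (L N : ℕ) (hN : 1 ≤ N) (hNL : N + 1 ≤ L) (u : ℝ) (lam : ℝ)
    (ha : 1 / L + u - lam ≠ 0) (hb : 1 / L - lam ≠ 0) :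
    (Matrix.of (fun x y : Fin L =>
        if x = y then u * (if (x : ℕ) < N then 1 else 0) else -1 / L)
      - lam • (1 : Matrix (Fin L) (Fin L) ℝ)).det
    = ((1 / L + u) - lam) ^ (N - 1) * ((1 / L : ℝ) - lam) ^ (L - N - 1)
      * ((1 / L + (u - 1 + Real.sqrt ((u + 1) ^ 2 - 4 * u * (N / L))) / 2) - lam)
      * ((1 / L + (u - 1 - Real.sqrt ((u + 1) ^ 2 - 4 * u * (N / L))) / 2) - lam) := by
  have hL0 : (0 : ℝ) < L := by exact_mod_cast (by omega : 0 < L)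
  have hnn : 0 ≤ (u + 1) ^ 2 - 4 * u * (N / L : ℝ) := by
    have h0 : (0 : ℝ) ≤ N / L := by positivity
    have h1 : (N / L : ℝ) ≤ 1 := by
      rw [div_le_one hL0]; exact_mod_cast (by omega : N ≤ L)
    nlinarith [mul_nonneg h0 (sq_nonneg (u - 1)),
      mul_nonneg (sub_nonneg.2 h1) (sq_nonneg (u + 1))]
  have hs := Real.sq_sqrt hnn
  set s := Real.sqrt ((u + 1) ^ 2 - 4 * u * (N / L : ℝ)) with hsdef
  have e : (Matrix.of (fun x y : Fin L =>
        if x = y then u * (if (x : ℕ) < N then 1 else 0) else -1 / L)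
      - lam • (1 : Matrix (Fin L) (Fin L) ℝ)) = Matrix.of (fun x y : Fin L =>
      (if x = y then (if (x : ℕ) < N then 1 / L + u - lam else 1 / L - lam) else 0)
        + (-1 / L : ℝ)) := by
    ext x y
    simp only [Matrix.of_apply, Matrix.sub_apply, Matrix.smul_apply, Matrix.one_apply,
      smul_eq_mul]
    split_ifs <;> ring
  rw [e, aux_det L N (by omega) _ _ _ ha hb]
  have key : (1 / L + (u - 1 + s) / 2 - lam) * (1 / L + (u - 1 - s) / 2 - lam)
      = (1 / L + u - lam) * (1 / L - lam) - (N / L) * (1 / L - lam)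
        - (1 - N / L) * (1 / L + u - lam) := by
    linear_combination (-1 / 4) * hs
  obtain ⟨n, rfl⟩ := Nat.exists_eq_add_of_le hN
  obtain ⟨m, rfl⟩ := Nat.exists_eq_add_of_le hNL
  rw [mul_assoc _ (1 / _ + (u - 1 + s) / 2 - lam), key]
  have e1 : 1 + n + 1 + m - (1 + n) = m + 1 := by omega
  rw [e1]
  simp only [Nat.add_sub_cancel, Nat.add_sub_cancel_left]
  generalize hA : 1 / ((1 + n + 1 + m : ℕ) : ℝ) + u - lam = A at *
  generalize hB : 1 / ((1 + n + 1 + m : ℕ) : ℝ) - lam = B at *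
  generalize ((1 + n + 1 + m : ℕ) : ℝ) = l at *
  generalize ((1 + n : ℕ) : ℝ) = k at *
  have hl : l ≠ 0 := hL0.ne'
  rw [add_comm 1 n, pow_succ, pow_succ]
  field_simp
  ring

/-- The characteristic determinant of the mean-field
Falicov–Kimball Hamiltonian `H₀` (nuclei on the first `N` of `L` sites)
factorizes as `(λ₂−λ)^{N−1}(λ₁−λ)^{L−N−1}(λ₊−λ)(λ₋−λ)` with `λ₁ = 1/L`,
`λ₂ = 1/L + u`, `λ± = 1/L + (u−1±Δ(N/L))/2`, `Δ(ρ) = √((u+1)²−4uρ)`. -/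
theorem stmt4 (L N : ℕ) (hL : 2 ≤ L) (hN : 1 ≤ N) (hNL : N ≤ L - 1) (u : ℝ) (lam : ℝ) :
    (Matrix.of (fun x y : Fin L =>
        if x = y then u * (if (x : ℕ) < N then 1 else 0) else -1 / L)
      - lam • (1 : Matrix (Fin L) (Fin L) ℝ)).det
    = ((1 / L + u) - lam) ^ (N - 1) * ((1 / L : ℝ) - lam) ^ (L - N - 1)
      * ((1 / L + (u - 1 + Real.sqrt ((u + 1) ^ 2 - 4 * u * (N / L))) / 2) - lam)
      * ((1 / L + (u - 1 - Real.sqrt ((u + 1) ^ 2 - 4 * u * (N / L))) / 2) - lam) := by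
  have hc := Continuous.ext_on (f := fun lam : ℝ => (Matrix.of (fun x y : Fin L =>
        if x = y then u * (if (x : ℕ) < N then 1 else 0) else -1 / L)
      - lam • (1 : Matrix (Fin L) (Fin L) ℝ)).det)
    (g := fun lam : ℝ => ((1 / L + u) - lam) ^ (N - 1) * ((1 / L : ℝ) - lam) ^ (L - N - 1)
      * ((1 / L + (u - 1 + Real.sqrt ((u + 1) ^ 2 - 4 * u * (N / L))) / 2) - lam)
      * ((1 / L + (u - 1 - Real.sqrt ((u + 1) ^ 2 - 4 * u * (N / L))) / 2) - lam))
    (s := (({1 / (L : ℝ) + u, 1 / (L : ℝ)} : Set ℝ))ᶜ)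
    (Set.Countable.dense_compl ℝ (Set.toFinite _).countable) (by fun_prop) (by fun_prop) (by
      intro x hx
      simp only [Set.mem_compl_iff, Set.mem_insert_iff, Set.mem_singleton_iff, not_or] at hx
      exact aux_main L N hN (by omega) u x (sub_ne_zero.2 (Ne.symm hx.1))
        (sub_ne_zero.2 (Ne.symm hx.2)))
  exact congrFun hc lam
end

section
/- Let u > 0 and define g : [0,1] → ℝ by g(ρ) = (u − 1 − Δ(ρ))/2 − ρ, where Δ(ρ) = √((u+1)² − 4uρ), and set ρ* = min(1/2 + 1/(4u), 1). Then: (i) g(0) = −1 and g(ρ) ≤ −1 for all ρ ∈ [0,1]; (ii) g is strictly decreasing on [0, ρ*] and strictly increasing on [ρ*, 1], so ρ* is the unique minimizer of g on [0,1]; (iii) the minimum value is g(ρ*) = u − 2 if 0 < u ≤ 1/2, and g(ρ*) = −1 − 1/(4u) if u ≥ 1/2; (iv) if u ≥ 1 then g(1) = −1. -/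
/-- Properties of `g(ρ) = (u−1−Δ(ρ))/2 − ρ`,
`Δ(ρ) = √((u+1)²−4uρ)`, for `u > 0`, with `ρ* = min(1/2 + 1/(4u), 1)`:
(i) `g(0) = −1` and `g ≤ −1` on `[0,1]`; (ii) `g` is strictly decreasing on
`[0,ρ*]`, strictly increasing on `[ρ*,1]`, and `ρ*` is the unique minimizer;
(iii) `g(ρ*) = u−2` if `0 < u ≤ 1/2` and `g(ρ*) = −1 − 1/(4u)` if `u ≥ 1/2`;
(iv) `g(1) = −1` if `u ≥ 1`. -/
theorem stmt8 (u : ℝ) (hu : 0 < u)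
    (g : ℝ → ℝ)
    (hg : ∀ ρ, g ρ = (u - 1 - Real.sqrt ((u + 1) ^ 2 - 4 * u * ρ)) / 2 - ρ)
    (ρs : ℝ) (hρs : ρs = min (1 / 2 + 1 / (4 * u)) 1) :
    g 0 = -1 ∧
    (∀ ρ ∈ Set.Icc (0 : ℝ) 1, g ρ ≤ -1) ∧
    StrictAntiOn g (Set.Icc 0 ρs) ∧
    StrictMonoOn g (Set.Icc ρs 1) ∧
    (∀ ρ ∈ Set.Icc (0 : ℝ) 1, ρ ≠ ρs → g ρs < g ρ) ∧
    (u ≤ 1 / 2 → g ρs = u - 2) ∧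
    (1 / 2 ≤ u → g ρs = -1 - 1 / (4 * u)) ∧
    (1 ≤ u → g 1 = -1) := by
  have hinv : 4 * u * (1 / 2 + 1 / (4 * u)) = 2 * u + 1 := by field_simp; ring
  have hle : 4 * u * ρs ≤ 2 * u + 1 := by
    rw [← hinv, hρs]
    exact mul_le_mul_of_nonneg_left (min_le_left _ _) (by positivity)
  have hs1 : ρs ≤ 1 := by rw [hρs]; exact min_le_right _ _
  have hs0 : 0 ≤ ρs := by rw [hρs]; exact le_min (by positivity) (by norm_num)
  have hrad : ∀ ρ : ℝ, ρ ≤ 1 → 0 ≤ (u + 1) ^ 2 - 4 * u * ρ := by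
    intro ρ h
    nlinarith [sq_nonneg (u - 1), mul_le_mul_of_nonneg_left h hu.le]
  have key : ∀ a b : ℝ, a ≤ 1 → b ≤ 1 → 4 * u * (g a - g b) =
      (√((u + 1) ^ 2 - 4 * u * a) - √((u + 1) ^ 2 - 4 * u * b)) *
      (√((u + 1) ^ 2 - 4 * u * a) + √((u + 1) ^ 2 - 4 * u * b) - 2 * u) := by
    intro a b ha hb
    have h1 := Real.sq_sqrt (hrad a ha)
    have h2 := Real.sq_sqrt (hrad b hb)
    rw [hg, hg]
    linear_combination h2 - h1
  have hlt : ∀ a b : ℝ, a < b → b ≤ 1 →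
      √((u + 1) ^ 2 - 4 * u * b) < √((u + 1) ^ 2 - 4 * u * a) := by
    intro a b hab hb
    apply Real.sqrt_lt_sqrt (hrad b hb)
    nlinarith [mul_lt_mul_of_pos_left hab hu]
  have hanti : StrictAntiOn g (Set.Icc 0 ρs) := by
    rintro a ⟨ha0, ha1⟩ b ⟨hb0, hb1⟩ hab
    have h1 := hlt a b hab (hb1.trans hs1)
    have h2 : u ≤ √((u + 1) ^ 2 - 4 * u * b) := by
      apply Real.le_sqrt_of_sq_le
      nlinarith [mul_le_mul_of_nonneg_left hb1 hu.le]
    have h3 := key a b (ha1.trans hs1) (hb1.trans hs1)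
    have h4 := mul_pos (sub_pos.2 h1) (by linarith :
      0 < √((u + 1) ^ 2 - 4 * u * a) + √((u + 1) ^ 2 - 4 * u * b) - 2 * u)
    rw [← h3] at h4
    exact sub_pos.1 (pos_of_mul_pos_right h4 (by positivity))
  have hmono : StrictMonoOn g (Set.Icc ρs 1) := by
    rintro a ⟨ha0, ha1⟩ b ⟨hb0, hb1⟩ hab
    have h1 := hlt a b hab hb1
    have hr : ρs = 1 / 2 + 1 / (4 * u) := by
      rcases min_choice (1 / 2 + 1 / (4 * u)) 1 with h | h
      · rw [hρs, h]
      · rw [h] at hρs; linarith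
    rw [← hr] at hinv
    have h2 : √((u + 1) ^ 2 - 4 * u * a) ≤ u := by
      apply Real.sqrt_le_iff.2 ⟨hu.le, _⟩
      nlinarith [mul_le_mul_of_nonneg_left ha0 hu.le]
    have h3 := key b a hb1 ha1
    have h4 := mul_pos_of_neg_of_neg (sub_neg.2 h1) (by linarith :
      √((u + 1) ^ 2 - 4 * u * b) + √((u + 1) ^ 2 - 4 * u * a) - 2 * u < 0)
    rw [← h3] at h4
    exact sub_pos.1 (pos_of_mul_pos_right h4 (by positivity))
  refine ⟨?_, ?_, hanti, hmono, ?_, ?_, ?_, ?_⟩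
  · rw [hg, mul_zero, sub_zero, sub_zero, Real.sqrt_sq (by linarith)]; ring
  · rintro ρ ⟨h0, h1⟩
    have : u + 1 - 2 * ρ ≤ √((u + 1) ^ 2 - 4 * u * ρ) := by
      apply Real.le_sqrt_of_sq_le
      nlinarith [mul_nonneg h0 (sub_nonneg.2 h1)]
    rw [hg]; linarith
  · rintro ρ ⟨h0, h1⟩ hne
    rcases lt_or_gt_of_ne hne with h | h
    · exact hanti ⟨h0, h.le⟩ ⟨hs0, le_rfl⟩ h
    · exact hmono ⟨le_rfl, hs1⟩ ⟨h.le, h1⟩ h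
  · intro h
    have hr : ρs = 1 := by
      rw [hρs]
      apply min_eq_right
      have : 1 / 2 ≤ 1 / (4 * u) := by
        rw [div_le_div_iff₀ (by norm_num) (by positivity)]; linarith
      linarith
    rw [hr, hg, show (u + 1) ^ 2 - 4 * u * 1 = (1 - u) ^ 2 by ring,
      Real.sqrt_sq (by linarith)]
    ring
  · intro h
    have hr : ρs = 1 / 2 + 1 / (4 * u) := by
      rw [hρs]
      apply min_eq_left
      have : 1 / (4 * u) ≤ 1 / 2 := by
        rw [div_le_div_iff₀ (by positivity) (by norm_num)]; linarith
      linarith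
    rw [hr, hg, hinv, show (u + 1) ^ 2 - (2 * u + 1) = u ^ 2 by ring,
      Real.sqrt_sq hu.le]
    ring
  · intro h
    rw [hg, show (u + 1) ^ 2 - 4 * u * 1 = (u - 1) ^ 2 by ring,
      Real.sqrt_sq (by linarith)]
    ring
end

section
/- Let u > 0 and let L ≥ 2 be an integer; set Δ(ρ) = √((u+1)² − 4uρ), g(ρ) = (u − 1 − Δ(ρ))/2 − ρ, ρ* = min(1/2 + 1/(4u), 1), and λ₋(ρ) = 1/L + (u − 1 − Δ(ρ))/2. Then for every integer 𝒩 with 1 ≤ 𝒩 ≤ L: (i) if (𝒩−1)/L ≤ ρ*, the minimum over integers N_n with 0 ≤ N_n ≤ 𝒩−1 of 𝒩/L + g(N_n/L) is attained at N_n = 𝒩−1, and equals λ₋((𝒩−1)/L); (ii) if (𝒩−1)/L > ρ*, this minimum is attained at an integer N_n ∈ {⌊ρ*L⌋, ⌈ρ*L⌉}. -/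
theorem fk_anti (u : ℝ) (hu : 0 < u) (a b : ℝ) (hab : a ≤ b) (hb : 4 * u * b ≤ 2 * u + 1) :
    (u - 1 - Real.sqrt ((u + 1) ^ 2 - 4 * u * b)) / 2 - b ≤
      (u - 1 - Real.sqrt ((u + 1) ^ 2 - 4 * u * a)) / 2 - a := by
  have hm : 4 * u * a ≤ 4 * u * b := by gcongr
  have hDb : u ≤ Real.sqrt ((u + 1) ^ 2 - 4 * u * b) := Real.le_sqrt_of_sq_le (by nlinarith)
  have hD : Real.sqrt ((u + 1) ^ 2 - 4 * u * b) ≤ Real.sqrt ((u + 1) ^ 2 - 4 * u * a) :=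
    Real.sqrt_le_sqrt (by linarith)
  have e1 := Real.sq_sqrt (show 0 ≤ (u + 1) ^ 2 - 4 * u * b by nlinarith)
  have e2 := Real.sq_sqrt (show 0 ≤ (u + 1) ^ 2 - 4 * u * a by nlinarith)
  set x := Real.sqrt ((u + 1) ^ 2 - 4 * u * b)
  set y := Real.sqrt ((u + 1) ^ 2 - 4 * u * a)
  have h : 0 ≤ (y - x) * (x + y - 2 * u) := mul_nonneg (by linarith) (by linarith)
  have h3 : 0 ≤ 4 * u * ((b - a) - (y - x) / 2) := by nlinarith
  have := nonneg_of_mul_nonneg_right h3 (by linarith)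
  linarith

theorem fk_mono (u : ℝ) (hu : 0 < u) (a b : ℝ) (hab : a ≤ b) (hb1 : b ≤ 1)
    (ha : 2 * u + 1 ≤ 4 * u * a) :
    (u - 1 - Real.sqrt ((u + 1) ^ 2 - 4 * u * a)) / 2 - a ≤
      (u - 1 - Real.sqrt ((u + 1) ^ 2 - 4 * u * b)) / 2 - b := by
  have hm : 4 * u * a ≤ 4 * u * b := by gcongr
  have hm1 : 4 * u * b ≤ 4 * u * 1 := by gcongr
  have hDa : Real.sqrt ((u + 1) ^ 2 - 4 * u * a) ≤ u := Real.sqrt_le_iff.2 ⟨hu.le, by nlinarith⟩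
  have hD : Real.sqrt ((u + 1) ^ 2 - 4 * u * b) ≤ Real.sqrt ((u + 1) ^ 2 - 4 * u * a) :=
    Real.sqrt_le_sqrt (by linarith)
  have e1 := Real.sq_sqrt (show 0 ≤ (u + 1) ^ 2 - 4 * u * b by nlinarith [sq_nonneg (u - 1)])
  have e2 := Real.sq_sqrt (show 0 ≤ (u + 1) ^ 2 - 4 * u * a by nlinarith [sq_nonneg (u - 1)])
  set x := Real.sqrt ((u + 1) ^ 2 - 4 * u * b)
  set y := Real.sqrt ((u + 1) ^ 2 - 4 * u * a)
  have h : 0 ≤ (y - x) * (2 * u - (x + y)) := mul_nonneg (by linarith) (by linarith)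
  have h3 : 0 ≤ 4 * u * ((y - x) / 2 - (b - a)) := by nlinarith
  have := nonneg_of_mul_nonneg_right h3 (by linarith)
  linarith

/-- Minimization of `E⁽²⁾(N_n, 𝒩−N_n) = 𝒩/L + g(N_n/L)` over
the nuclei number `N_n ∈ {0,…,𝒩−1}` for `u > 0` and `1 ≤ 𝒩 ≤ L`:
(i) if `(𝒩−1)/L ≤ ρ*` the minimum is attained at `N_n = 𝒩−1` and equals
`λ₋((𝒩−1)/L)`; (ii) if `(𝒩−1)/L > ρ*` the minimum is attained at an integer
`N_n ∈ {⌊ρ*L⌋, ⌈ρ*L⌉}`. -/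
theorem stmt10 (u : ℝ) (hu : 0 < u) (L : ℕ) (hL : 2 ≤ L)
    (g : ℝ → ℝ)
    (hg : ∀ ρ, g ρ = (u - 1 - Real.sqrt ((u + 1) ^ 2 - 4 * u * ρ)) / 2 - ρ)
    (ρs : ℝ) (hρs : ρs = min (1 / 2 + 1 / (4 * u)) 1)
    (𝒩 : ℕ) (h1 : 1 ≤ 𝒩) (h2 : 𝒩 ≤ L) :
    (((𝒩 : ℝ) - 1) / L ≤ ρs →
      (∀ Nn : ℕ, Nn ≤ 𝒩 - 1 →
        (𝒩 : ℝ) / L + g (((𝒩 : ℝ) - 1) / L) ≤ (𝒩 : ℝ) / L + g ((Nn : ℝ) / L)) ∧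
      (𝒩 : ℝ) / L + g (((𝒩 : ℝ) - 1) / L)
        = 1 / L + (u - 1 - Real.sqrt ((u + 1) ^ 2 - 4 * u * (((𝒩 : ℝ) - 1) / L))) / 2)
    ∧ (ρs < ((𝒩 : ℝ) - 1) / L →
      ∃ Nn : ℕ, (Nn = ⌊ρs * L⌋₊ ∨ Nn = ⌈ρs * L⌉₊) ∧ Nn ≤ 𝒩 - 1 ∧
        ∀ Nn' : ℕ, Nn' ≤ 𝒩 - 1 →
          (𝒩 : ℝ) / L + g ((Nn : ℝ) / L) ≤ (𝒩 : ℝ) / L + g ((Nn' : ℝ) / L)) := by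
  have hL0 : (0 : ℝ) < L := by exact_mod_cast (by omega : 0 < L)
  have hr : 4 * u * (1 / 2 + 1 / (4 * u)) = 2 * u + 1 := by field_simp; ring
  have hN : (((𝒩 - 1 : ℕ) : ℕ) : ℝ) = (𝒩 : ℝ) - 1 := by push_cast [h1]; ring
  have hNL : (𝒩 : ℝ) ≤ L := by exact_mod_cast h2
  have anti : ∀ a b : ℝ, a ≤ b → b ≤ ρs → g b ≤ g a := by
    intro a b hab hb
    rw [hg, hg]
    refine fk_anti u hu a b hab ?_
    rw [← hr]
    have : b ≤ 1 / 2 + 1 / (4 * u) := hb.trans (hρs ▸ min_le_left _ _)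
    gcongr
  refine ⟨fun h => ⟨fun n hn => ?_, ?_⟩, fun h => ?_⟩
  · have hn' : (n : ℝ) ≤ (𝒩 : ℝ) - 1 := by rw [← hN]; exact_mod_cast hn
    have := anti (n / L) (((𝒩 : ℝ) - 1) / L) (by gcongr) h
    linarith
  · rw [hg]; ring
  · have hlt1 : ((𝒩 : ℝ) - 1) / L ≤ 1 := by rw [div_le_one hL0]; linarith
    have hs : ρs = 1 / 2 + 1 / (4 * u) := by
      rw [hρs]
      rcases min_choice (1 / 2 + 1 / (4 * u)) 1 with h' | h'
      · exact h'
      · rw [hρs, h'] at h; linarith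
    have hs0 : 0 < ρs := by rw [hs]; positivity
    have hsL : 0 ≤ ρs * L := by positivity
    have mono : ∀ a b : ℝ, a ≤ b → b ≤ 1 → ρs ≤ a → g a ≤ g b := by
      intro a b hab hb ha
      rw [hg, hg]
      refine fk_mono u hu a b hab hb ?_
      rw [← hr, ← hs]
      gcongr
    have hc : ⌈ρs * L⌉₊ ≤ 𝒩 - 1 := by
      rw [Nat.ceil_le, hN]
      exact ((lt_div_iff₀ hL0).1 h).le
    have hf : ⌊ρs * L⌋₊ ≤ 𝒩 - 1 := (Nat.floor_le_ceil _).trans hc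
    have key : ∀ n : ℕ, n ≤ 𝒩 - 1 → g ((⌊ρs * L⌋₊ : ℕ) / L) ≤ g (n / L) ∨
        g ((⌈ρs * L⌉₊ : ℕ) / L) ≤ g (n / L) := by
      intro n hn
      rcases le_total (n : ℝ) (ρs * L) with h' | h'
      · left
        have : n ≤ ⌊ρs * L⌋₊ := Nat.le_floor h'
        refine anti _ _ (by gcongr) ?_
        rw [div_le_iff₀ hL0]
        exact Nat.floor_le hsL
      · right
        have : ⌈ρs * L⌉₊ ≤ n := Nat.ceil_le.2 h'
        refine mono _ _ (by gcongr) ?_ ?_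
        · refine le_trans ?_ hlt1
          have hn' : (n : ℝ) ≤ (𝒩 : ℝ) - 1 := by rw [← hN]; exact_mod_cast hn
          gcongr
        · rw [le_div_iff₀ hL0]
          exact Nat.le_ceil _
    rcases le_total (g ((⌊ρs * L⌋₊ : ℕ) / L)) (g ((⌈ρs * L⌉₊ : ℕ) / L)) with h' | h'
    · refine ⟨_, Or.inl rfl, hf, fun n hn => ?_⟩
      rcases key n hn with k | k <;> linarith
    · refine ⟨_, Or.inr rfl, hc, fun n hn => ?_⟩
      rcases key n hn with k | k <;> linarith
end

section
/- Let u > 0 and let L ≥ 2 be an integer. Define E₊ on integers 1 ≤ 𝒩 ≤ 2L by E₊(𝒩) = 𝒩/L + min{ g(N_n/L) : N_n integer, 0 ≤ N_n ≤ 𝒩−1 } for 1 ≤ 𝒩 ≤ L, and E₊(𝒩) = (𝒩 − L)(1/L + u) − 1 for L < 𝒩 ≤ 2L, where g(ρ) = (u − 1 − Δ(ρ))/2 − ρ and Δ(ρ) = √((u+1)² − 4uρ). Then E₊ is strictly increasing on {1, 2, …, 2L}. -/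
/-- For `u > 0` and `L ≥ 2`, the ground state energy
`E₊(𝒩) = 𝒩/L + min{g(N_n/L) : 0 ≤ N_n ≤ 𝒩−1}` for `1 ≤ 𝒩 ≤ L` and
`E₊(𝒩) = (𝒩−L)(1/L+u) − 1` for `L < 𝒩 ≤ 2L` is strictly increasing on
`{1,…,2L}`. -/
theorem stmt11 (u : ℝ) (hu : 0 < u) (L : ℕ) (hL : 2 ≤ L)
    (g : ℝ → ℝ)
    (hg : ∀ ρ, g ρ = (u - 1 - Real.sqrt ((u + 1) ^ 2 - 4 * u * ρ)) / 2 - ρ)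
    (E : ℕ → ℝ)
    (hE1 : ∀ 𝒩 : ℕ, 1 ≤ 𝒩 → 𝒩 ≤ L →
      E 𝒩 = (𝒩 : ℝ) / L + sInf ((fun Nn : ℕ => g ((Nn : ℝ) / L)) '' Set.Iic (𝒩 - 1)))
    (hE2 : ∀ 𝒩 : ℕ, L < 𝒩 → 𝒩 ≤ 2 * L →
      E 𝒩 = ((𝒩 : ℝ) - L) * (1 / L + u) - 1) :
    ∀ a b : ℕ, 1 ≤ a → a < b → b ≤ 2 * L → E a < E b := by
  have hL0 : (0 : ℝ) < L := by
    have : 0 < L := by omega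
    exact_mod_cast this
  have hfin : ∀ n : ℕ, ((fun Nn : ℕ => g ((Nn : ℝ) / L)) '' Set.Iic n).Finite :=
    fun n => (Set.finite_Iic n).image _
  have hle : ∀ n k : ℕ, k ≤ n →
      sInf ((fun Nn : ℕ => g ((Nn : ℝ) / L)) '' Set.Iic n) ≤ g ((k : ℝ) / L) :=
    fun n k hk => csInf_le (hfin n).bddBelow ⟨k, hk, rfl⟩
  have step : ∀ n : ℕ, 1 ≤ n → n + 1 ≤ 2 * L → E n < E (n + 1) := by
    intro n hn hn2
    obtain ⟨m, rfl⟩ : ∃ m, n = m + 1 := ⟨n - 1, by omega⟩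
    rcases lt_trichotomy (m + 1) L with h | h | h
    · rw [hE1 (m + 1) hn h.le, hE1 (m + 1 + 1) (by omega) h]
      simp only [Nat.add_sub_cancel]
      have hpos : (0 : ℝ) < 1 / L := by positivity
      have e1 : (((m + 1 + 1 : ℕ) : ℝ)) / L = ((m + 1 : ℕ) : ℝ) / L + 1 / L := by
        push_cast; ring
      rw [e1]
      have hmem := Set.Nonempty.csInf_mem
        (s := (fun Nn : ℕ => g ((Nn : ℝ) / L)) '' Set.Iic (m + 1))
        ⟨_, ⟨0, Nat.zero_le _, rfl⟩⟩ (hfin _)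
      obtain ⟨k, hk, hkeq⟩ := hmem
      rw [← hkeq]
      simp only [Set.mem_Iic] at hk
      rcases Nat.lt_or_ge k (m + 1) with hk' | hk'
      · have := hle m k (by omega)
        simp only
        linarith
      · obtain rfl : k = m + 1 := by omega
        have h1 := hle m m le_rfl
        have e2 : (((m + 1 : ℕ) : ℝ)) / L = (m : ℝ) / L + 1 / L := by
          push_cast; ring
        have hm1 : (((m + 1 : ℕ) : ℝ)) / L < 1 := by
          rw [div_lt_one hL0]; exact_mod_cast h
        have hs : Real.sqrt ((u + 1) ^ 2 - 4 * u * (((m + 1 : ℕ) : ℝ) / L))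
            < Real.sqrt ((u + 1) ^ 2 - 4 * u * ((m : ℝ) / L)) := by
          apply Real.sqrt_lt_sqrt
          · nlinarith [sq_nonneg (u - 1)]
          · rw [e2]; nlinarith
        have g1 := hg ((m : ℝ) / L)
        have g2 := hg (((m + 1 : ℕ) : ℝ) / L)
        simp only
        linarith
    · rw [hE1 (m + 1) hn h.le, hE2 (m + 1 + 1) (by omega) hn2]
      simp only [Nat.add_sub_cancel]
      have h1 := hle m m le_rfl
      have hc : (m : ℝ) + 1 = L := by exact_mod_cast h
      have e2 : (m : ℝ) / L = 1 - 1 / L := by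
        field_simp; linarith
      have e3 : (((m + 1 : ℕ) : ℝ)) / L = 1 := by
        rw [h]; exact div_self hL0.ne'
      have e4 : (((m + 1 + 1 : ℕ) : ℝ)) - L = 1 := by
        push_cast; linarith
      have hpos : (0 : ℝ) < 1 / L := by positivity
      have g1 := hg ((m : ℝ) / L)
      have hs : 1 - u < Real.sqrt ((u + 1) ^ 2 - 4 * u * ((m : ℝ) / L)) := by
        apply Real.lt_sqrt_of_sq_lt
        rw [e2]; nlinarith [mul_pos hu hpos]
      rw [e3, e4]
      linarith
    · rw [hE2 (m + 1) h (by omega), hE2 (m + 1 + 1) (by omega) hn2]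
      have hpos : (0 : ℝ) < 1 / L + u := by positivity
      push_cast
      linarith
  intro a b ha hab
  induction b, hab using Nat.le_induction with
  | base => intro hb; exact step a ha hb
  | succ b hb ih =>
    intro h
    exact (ih (by omega)).trans (step b (by omega) h)
end

section
/- Let u < 0 and let L be an integer with L > 1/|u|. Define E₋ on integers 1 ≤ 𝒩 ≤ 2L by E₋(𝒩) = (u/2)(𝒩 − 1) + 𝒩/(2L) − m(𝒩)/2, where m(𝒩) = max(2 − 1/L, 1 + Δ(𝒩/(2L))) and Δ(ρ) = √((u+1)² − 4uρ). Then E₋ is strictly decreasing on {1, 2, …, 2L}. -/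
/-- For `u < 0` and `L > 1/|u|`, the ground state energy
`E₋(𝒩) = (u/2)(𝒩−1) + 𝒩/(2L) − m(𝒩)/2` with
`m(𝒩) = max(2 − 1/L, 1 + Δ(𝒩/(2L)))`, `Δ(ρ) = √((u+1)²−4uρ)`, is strictly
decreasing on `{1,…,2L}`. -/
theorem stmt12 (u : ℝ) (hu : u < 0) (L : ℕ) (hL : 1 / |u| < (L : ℝ))
    (E : ℕ → ℝ)
    (hE : ∀ 𝒩 : ℕ, E 𝒩 = (u / 2) * ((𝒩 : ℝ) - 1) + (𝒩 : ℝ) / (2 * L)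
      - (max (2 - 1 / (L : ℝ))
          (1 + Real.sqrt ((u + 1) ^ 2 - 4 * u * ((𝒩 : ℝ) / (2 * L))))) / 2) :
    ∀ a b : ℕ, 1 ≤ a → a < b → b ≤ 2 * L → E b < E a := by
  intro a b _ hab _
  have hL0 : (0 : ℝ) < L := lt_of_le_of_lt (by positivity) hL
  rw [abs_of_neg hu, div_lt_iff₀ (by linarith)] at hL
  have hab' : (a : ℝ) < b := by exact_mod_cast hab
  have hd : (a : ℝ) / (2 * L) ≤ (b : ℝ) / (2 * L) := by gcongr
  have hm : max (2 - 1 / (L : ℝ))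
          (1 + Real.sqrt ((u + 1) ^ 2 - 4 * u * ((a : ℝ) / (2 * L)))) ≤
      max (2 - 1 / (L : ℝ))
          (1 + Real.sqrt ((u + 1) ^ 2 - 4 * u * ((b : ℝ) / (2 * L)))) := by
    apply max_le_max le_rfl
    have := Real.sqrt_le_sqrt (show (u + 1) ^ 2 - 4 * u * ((a : ℝ) / (2 * L)) ≤
      (u + 1) ^ 2 - 4 * u * ((b : ℝ) / (2 * L)) by nlinarith)
    linarith
  have hlin : (b : ℝ) / (2 * L) - (a : ℝ) / (2 * L) < -(u / 2) * ((b : ℝ) - a) := by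
    rw [← sub_div, div_lt_iff₀ (by positivity)]
    nlinarith [mul_pos (sub_pos.2 hab') (sub_pos.2 hL)]
  rw [hE a, hE b]
  linarith
end

section
/- Let u > 0. For each integer L ≥ 2 define E₊ on integers 1 ≤ 𝒩 ≤ 2L by E₊(𝒩) = 𝒩/L + min{ g(N_n/L) : N_n integer, 0 ≤ N_n ≤ 𝒩−1 } for 1 ≤ 𝒩 ≤ L and E₊(𝒩) = (𝒩 − L)(1/L + u) − 1 for L < 𝒩 ≤ 2L, where g(ρ) = (u − 1 − √((u+1)² − 4uρ))/2 − ρ. Then for every ρ ∈ (0,1] one has lim_{L→∞} E₊(⌊ρL⌋)/L = 0, and for every ρ ∈ (1,2] one has lim_{L→∞} E₊(⌊ρL⌋)/L = (ρ − 1)u. -/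
/-- Thermodynamic limit of the ground state energy density
for `u > 0`: with `E₊ = E L 𝒩` defined by `𝒩/L + min{g(N_n/L) : 0 ≤ N_n ≤ 𝒩−1}`
for `1 ≤ 𝒩 ≤ L` and `(𝒩−L)(1/L+u) − 1` for `L < 𝒩 ≤ 2L`, one has
`E L ⌊ρL⌋/L → 0` for `ρ ∈ (0,1]` and `E L ⌊ρL⌋/L → (ρ−1)u` for `ρ ∈ (1,2]`. -/
theorem stmt13 (u : ℝ) (hu : 0 < u)
    (g : ℝ → ℝ)
    (hg : ∀ ρ, g ρ = (u - 1 - Real.sqrt ((u + 1) ^ 2 - 4 * u * ρ)) / 2 - ρ)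
    (E : ℕ → ℕ → ℝ)
    (hE1 : ∀ L 𝒩 : ℕ, 2 ≤ L → 1 ≤ 𝒩 → 𝒩 ≤ L →
      E L 𝒩 = (𝒩 : ℝ) / L + sInf ((fun Nn : ℕ => g ((Nn : ℝ) / L)) '' Set.Iic (𝒩 - 1)))
    (hE2 : ∀ L 𝒩 : ℕ, 2 ≤ L → L < 𝒩 → 𝒩 ≤ 2 * L →
      E L 𝒩 = ((𝒩 : ℝ) - L) * (1 / L + u) - 1) :
    (∀ ρ ∈ Set.Ioc (0 : ℝ) 1,
      Filter.Tendsto (fun L : ℕ => E L ⌊ρ * L⌋₊ / L) Filter.atTop (nhds 0)) ∧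
    (∀ ρ ∈ Set.Ioc (1 : ℝ) 2,
      Filter.Tendsto (fun L : ℕ => E L ⌊ρ * L⌋₊ / L) Filter.atTop (nhds ((ρ - 1) * u))) := by
  have hcast : Filter.Tendsto (fun L : ℕ => (L : ℝ)) Filter.atTop Filter.atTop :=
    tendsto_natCast_atTop_atTop
  refine ⟨?_, ?_⟩
  · rintro ρ ⟨h0, h1⟩
    have hlim : Filter.Tendsto (fun L : ℕ => (u + 3) / (L : ℝ)) Filter.atTop (nhds 0) :=
      hcast.const_div_atTop _
    refine squeeze_zero_norm' ?_ hlim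
    filter_upwards [Filter.eventually_ge_atTop 2, hcast.eventually_ge_atTop (1 / ρ)] with L hL hL'
    have hLpos : (0 : ℝ) < L := by
      have : 0 < L := by omega
      exact_mod_cast this
    have hN1 : 1 ≤ ⌊ρ * L⌋₊ := by
      apply Nat.le_floor
      rw [div_le_iff₀ h0] at hL'
      push_cast
      linarith
    have hNL : ⌊ρ * L⌋₊ ≤ L := by
      apply Nat.floor_le_of_le
      nlinarith
    rw [norm_div, Real.norm_natCast]
    gcongr
    rw [hE1 L _ hL hN1 hNL]
    generalize ⌊ρ * L⌋₊ = N at hN1 hNL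
    have hNr : (N : ℝ) / L ≤ 1 := by
      rw [div_le_one hLpos]; exact_mod_cast hNL
    have hNr0 : 0 ≤ (N : ℝ) / L := by positivity
    have hb : ∀ y ∈ ((fun Nn : ℕ => g ((Nn : ℝ) / L)) '' Set.Iic (N - 1)), -2 ≤ y := by
      rintro _ ⟨n, hn, rfl⟩
      have hn' : n ≤ L := by
        have : n ≤ N - 1 := hn
        omega
      have hx1 : (n : ℝ) / L ≤ 1 := by
        rw [div_le_one hLpos]; exact_mod_cast hn'
      have hx0 : 0 ≤ (n : ℝ) / L := by positivity
      simp only [hg]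
      have : Real.sqrt ((u + 1) ^ 2 - 4 * u * ((n : ℝ) / L)) ≤ u + 1 := by
        apply Real.sqrt_le_iff.2 ⟨by linarith, ?_⟩
        have := mul_nonneg hu.le hx0
        linarith
      linarith
    have hmem : g (((0 : ℕ) : ℝ) / L) ∈ ((fun Nn : ℕ => g ((Nn : ℝ) / L)) '' Set.Iic (N - 1)) :=
      ⟨0, Nat.zero_le _, rfl⟩
    have hlo := le_csInf ⟨_, hmem⟩ hb
    have hhi := csInf_le ⟨-2, hb⟩ hmem
    have hg0 : g (((0 : ℕ) : ℝ) / L) ≤ u := by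
      rw [hg]
      have := Real.sqrt_nonneg ((u + 1) ^ 2 - 4 * u * (((0 : ℕ) : ℝ) / L))
      have h00 : (((0 : ℕ) : ℝ) / L) = 0 := by simp
      linarith
    rw [Real.norm_eq_abs, abs_le]
    constructor <;> linarith
  · rintro ρ ⟨h1, h2⟩
    have hfl : Filter.Tendsto (fun L : ℕ => ((⌊ρ * L⌋₊ : ℕ) : ℝ) / (L : ℝ)) Filter.atTop (nhds ρ) :=
      (tendsto_nat_floor_mul_div_atTop (by linarith : (0 : ℝ) ≤ ρ)).comp hcast
    have hinv : Filter.Tendsto (fun L : ℕ => 1 / (L : ℝ)) Filter.atTop (nhds 0) :=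
      hcast.const_div_atTop _
    have hlim := ((hfl.sub_const 1).mul (hinv.add_const u)).sub hinv
    simp only [zero_add, sub_zero] at hlim
    refine hlim.congr' ?_
    filter_upwards [Filter.eventually_ge_atTop 2, hcast.eventually_ge_atTop (1 / (ρ - 1))]
      with L hL hL'
    have hLpos : (0 : ℝ) < L := by
      have : 0 < L := by omega
      exact_mod_cast this
    rw [div_le_iff₀ (by linarith)] at hL'
    have hN1 : L < ⌊ρ * L⌋₊ := by
      apply Nat.le_floor
      push_cast
      linarith
    have hN2 : ⌊ρ * L⌋₊ ≤ 2 * L := by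
      apply Nat.floor_le_of_le
      push_cast
      nlinarith
    rw [hE2 L _ hL hN1 hN2]
    field_simp
end

section
/- Let u > 0. For each integer L ≥ 2 define E₊ on integers 1 ≤ 𝒩 ≤ 2L by E₊(𝒩) = 𝒩/L + min{ g(N_n/L) : N_n integer, 0 ≤ N_n ≤ 𝒩−1 } for 1 ≤ 𝒩 ≤ L and E₊(𝒩) = (𝒩 − L)(1/L + u) − 1 for L < 𝒩 ≤ 2L, where g(ρ) = (u − 1 − √((u+1)² − 4uρ))/2 − ρ, and define the chemical potential μ_L(ρ) = E₊(⌊ρL⌋ + 1) − E₊(⌊ρL⌋). Then for every ρ ∈ (0,1), lim_{L→∞} μ_L(ρ) = 0, and for every ρ ∈ (1,2), lim_{L→∞} μ_L(ρ) = u. In particular, in the thermodynamic limit the chemical potential has a discontinuity of size u at the half-filled band ρ = 1 (a first kind gap). -/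
/-- Chemical potential `μ_L(ρ) = E₊(⌊ρL⌋+1) − E₊(⌊ρL⌋)` of
the mean-field Falicov–Kimball model for `u > 0`: `μ_L(ρ) → 0` for
`ρ ∈ (0,1)` and `μ_L(ρ) → u` for `ρ ∈ (1,2)` as `L → ∞`; hence the chemical
potential has a discontinuity of size `u` at the half-filled band `ρ = 1`
(a first kind gap). -/
theorem stmt14 (u : ℝ) (hu : 0 < u)
    (g : ℝ → ℝ)
    (hg : ∀ ρ, g ρ = (u - 1 - Real.sqrt ((u + 1) ^ 2 - 4 * u * ρ)) / 2 - ρ)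
    (E : ℕ → ℕ → ℝ)
    (hE1 : ∀ L 𝒩 : ℕ, 2 ≤ L → 1 ≤ 𝒩 → 𝒩 ≤ L →
      E L 𝒩 = (𝒩 : ℝ) / L + sInf ((fun Nn : ℕ => g ((Nn : ℝ) / L)) '' Set.Iic (𝒩 - 1)))
    (hE2 : ∀ L 𝒩 : ℕ, 2 ≤ L → L < 𝒩 → 𝒩 ≤ 2 * L →
      E L 𝒩 = ((𝒩 : ℝ) - L) * (1 / L + u) - 1) :
    (∀ ρ ∈ Set.Ioo (0 : ℝ) 1,
      Filter.Tendsto (fun L : ℕ => E L (⌊ρ * L⌋₊ + 1) - E L ⌊ρ * L⌋₊)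
        Filter.atTop (nhds 0)) ∧
    (∀ ρ ∈ Set.Ioo (1 : ℝ) 2,
      Filter.Tendsto (fun L : ℕ => E L (⌊ρ * L⌋₊ + 1) - E L ⌊ρ * L⌋₊)
        Filter.atTop (nhds u)) := by
  have hinv : Filter.Tendsto (fun L : ℕ => 1 / (L : ℝ)) Filter.atTop (nhds 0) :=
    tendsto_one_div_atTop_nhds_zero_nat
  constructor
  · rintro ρ ⟨h0, h1⟩
    have hgc : Continuous g := by
      have : g = fun ρ => (u - 1 - Real.sqrt ((u + 1) ^ 2 - 4 * u * ρ)) / 2 - ρ := funext hg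
      rw [this]
      fun_prop
    have ha : Filter.Tendsto (fun L : ℕ => ((⌊ρ * L⌋₊ : ℕ) : ℝ) / L) Filter.atTop (nhds ρ) :=
      (tendsto_nat_floor_mul_div_atTop h0.le).comp tendsto_natCast_atTop_atTop
    have hb : Filter.Tendsto (fun L : ℕ => ((⌊ρ * L⌋₊ : ℕ) : ℝ) / L - 1 / L)
        Filter.atTop (nhds ρ) := by
      simpa using ha.sub hinv
    have hd : Filter.Tendsto (fun L : ℕ => 1 / (L : ℝ) -
        |g (((⌊ρ * L⌋₊ : ℕ) : ℝ) / L) - g (((⌊ρ * L⌋₊ : ℕ) : ℝ) / L - 1 / L)|)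
        Filter.atTop (nhds 0) := by
      have h := hinv.sub ((((hgc.tendsto ρ).comp ha).sub ((hgc.tendsto ρ).comp hb)).abs)
      simpa using h
    have key : ∀ᶠ L : ℕ in Filter.atTop,
        (1 / (L : ℝ) -
          |g (((⌊ρ * L⌋₊ : ℕ) : ℝ) / L) - g (((⌊ρ * L⌋₊ : ℕ) : ℝ) / L - 1 / L)|
          ≤ E L (⌊ρ * L⌋₊ + 1) - E L ⌊ρ * L⌋₊) ∧
        E L (⌊ρ * L⌋₊ + 1) - E L ⌊ρ * L⌋₊ ≤ 1 / (L : ℝ) := by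
      filter_upwards [Filter.eventually_ge_atTop 2,
        tendsto_natCast_atTop_atTop.eventually_ge_atTop (1 / ρ)] with L hL hLρ
      have hLpos : (0 : ℝ) < L := by positivity
      have hN1 : 1 ≤ ⌊ρ * L⌋₊ := by
        apply Nat.le_floor
        rw [div_le_iff₀ h0] at hLρ
        push_cast
        linarith
      have hN2 : ⌊ρ * L⌋₊ < L := by
        rw [Nat.floor_lt (by positivity)]
        nlinarith
      generalize ⌊ρ * L⌋₊ = N at hN1 hN2 ⊢
      rw [hE1 L (N + 1) hL (by omega) (by omega), hE1 L N hL hN1 hN2.le]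
      obtain ⟨M, rfl⟩ : ∃ M, N = M + 1 := ⟨N - 1, by omega⟩
      simp only [Nat.add_sub_cancel]
      have e1 : (((M + 1 : ℕ) : ℝ)) / L - 1 / L = (M : ℝ) / L := by push_cast; ring
      have e2 : (((M + 1 + 1 : ℕ) : ℝ)) / L = ((M + 1 : ℕ) : ℝ) / L + 1 / L := by
        push_cast; ring
      rw [e1, e2]
      have bdd : ∀ K : ℕ, BddBelow ((fun Nn : ℕ => g ((Nn : ℝ) / L)) '' Set.Iic K) :=
        fun K => ((Set.finite_Iic K).image _).bddBelow
      have hle : sInf ((fun Nn : ℕ => g ((Nn : ℝ) / L)) '' Set.Iic (M + 1)) ≤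
          sInf ((fun Nn : ℕ => g ((Nn : ℝ) / L)) '' Set.Iic M) :=
        csInf_le_csInf (bdd _) (Set.Nonempty.image _ ⟨M, le_refl M⟩)
          (Set.image_mono (Set.Iic_subset_Iic.2 (Nat.le_succ M)))
      have hge : sInf ((fun Nn : ℕ => g ((Nn : ℝ) / L)) '' Set.Iic M) -
          |g (((M + 1 : ℕ) : ℝ) / L) - g ((M : ℝ) / L)| ≤
          sInf ((fun Nn : ℕ => g ((Nn : ℝ) / L)) '' Set.Iic (M + 1)) := by
        apply le_csInf (Set.Nonempty.image _ Set.nonempty_Iic)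
        rintro _ ⟨k, hk, rfl⟩
        have hk' : k ≤ M + 1 := hk
        rcases Nat.lt_or_ge M k with h | h
        · obtain rfl : k = M + 1 := by omega
          have := csInf_le (bdd M) ⟨M, le_refl M, rfl⟩
          have h3 := neg_abs_le (g (((M + 1 : ℕ) : ℝ) / L) - g ((M : ℝ) / L))
          dsimp only at this ⊢
          linarith
        · have := csInf_le (bdd M) ⟨k, h, rfl⟩
          have h3 := abs_nonneg (g (((M + 1 : ℕ) : ℝ) / L) - g ((M : ℝ) / L))
          dsimp only at this ⊢
          linarith
      constructor <;> linarith
    exact tendsto_of_tendsto_of_tendsto_of_le_of_le' hd hinv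
      (key.mono fun _ h => h.1) (key.mono fun _ h => h.2)
  · rintro ρ ⟨h1, h2⟩
    have hlim : Filter.Tendsto (fun L : ℕ => 1 / (L : ℝ) + u) Filter.atTop (nhds u) := by
      simpa using hinv.add_const u
    refine hlim.congr' ?_
    filter_upwards [Filter.eventually_ge_atTop 2,
      tendsto_natCast_atTop_atTop.eventually_ge_atTop (1 / (ρ - 1))] with L hL hLρ
    have hLpos : (0 : ℝ) < L := by positivity
    have hN1 : L + 1 ≤ ⌊ρ * L⌋₊ := by
      apply Nat.le_floor
      rw [div_le_iff₀ (by linarith)] at hLρ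
      push_cast
      linarith
    have hN2 : ⌊ρ * L⌋₊ < 2 * L := by
      rw [Nat.floor_lt (by positivity)]
      push_cast
      nlinarith
    rw [hE2 L _ hL (by omega) (by omega), hE2 L ⌊ρ * L⌋₊ hL (by omega) (by omega)]
    push_cast
    ring
end

section
/- Let u < 0. For each integer L with L > 1/|u| define E₋ on integers 1 ≤ 𝒩 ≤ 2L by E₋(𝒩) = (u/2)(𝒩 − 1) + 𝒩/(2L) − m(𝒩)/2, where m(𝒩) = max(2 − 1/L, 1 + √((u+1)² − 2u𝒩/L)). Then for every ρ ∈ (0,2], lim_{L→∞} E₋(⌊ρL⌋)/L = uρ/2, and for every ρ ∈ (0,2), lim_{L→∞} [E₋(⌊ρL⌋ + 1) − E₋(⌊ρL⌋)] = u/2. In particular the limiting energy density e(ρ) = uρ/2 is differentiable on (0,2), so there is no first kind gap for attractive interaction. -/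
/-- For `u < 0`, with
`E₋(𝒩) = (u/2)(𝒩−1) + 𝒩/(2L) − m(𝒩)/2`,
`m(𝒩) = max(2 − 1/L, 1 + √((u+1)² − 2u𝒩/L))` (defined for `L > 1/|u|`,
`1 ≤ 𝒩 ≤ 2L`): the energy density `E₋(⌊ρL⌋)/L → uρ/2` for all `ρ ∈ (0,2]`,
and the chemical potential `E₋(⌊ρL⌋+1) − E₋(⌊ρL⌋) → u/2` for all `ρ ∈ (0,2)`;
so the limiting energy density is differentiable and there is no first kind
gap for attractive interaction. -/
theorem stmt15 (u : ℝ) (hu : u < 0)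
    (E : ℕ → ℕ → ℝ)
    (hE : ∀ L 𝒩 : ℕ, 1 / |u| < (L : ℝ) → 1 ≤ 𝒩 → 𝒩 ≤ 2 * L →
      E L 𝒩 = (u / 2) * ((𝒩 : ℝ) - 1) + (𝒩 : ℝ) / (2 * L)
        - (max (2 - 1 / (L : ℝ))
            (1 + Real.sqrt ((u + 1) ^ 2 - 2 * u * (𝒩 : ℝ) / L))) / 2) :
    (∀ ρ ∈ Set.Ioc (0 : ℝ) 2,
      Filter.Tendsto (fun L : ℕ => E L ⌊ρ * L⌋₊ / L) Filter.atTop (nhds (u * ρ / 2))) ∧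
    (∀ ρ ∈ Set.Ioo (0 : ℝ) 2,
      Filter.Tendsto (fun L : ℕ => E L (⌊ρ * L⌋₊ + 1) - E L ⌊ρ * L⌋₊)
        Filter.atTop (nhds (u / 2))) := by
  have hinv : Filter.Tendsto (fun L : ℕ => 1 / (L : ℝ)) Filter.atTop (nhds 0) :=
    tendsto_one_div_atTop_nhds_zero_nat
  have ha : ∀ ρ : ℝ, 0 < ρ → Filter.Tendsto (fun L : ℕ => (⌊ρ * L⌋₊ : ℝ) / L)
      Filter.atTop (nhds ρ) := fun ρ h =>
    (tendsto_nat_floor_mul_div_atTop h.le).comp tendsto_natCast_atTop_atTop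
  have hM : ∀ (ρ : ℝ) (a : ℕ → ℝ), Filter.Tendsto a Filter.atTop (nhds ρ) →
      Filter.Tendsto (fun L : ℕ => max (2 - 1 / (L : ℝ))
        (1 + Real.sqrt ((u + 1) ^ 2 - 2 * u * a L))) Filter.atTop
        (nhds (max (2 - 0) (1 + Real.sqrt ((u + 1) ^ 2 - 2 * u * ρ)))) := by
    intro ρ a h
    exact (tendsto_const_nhds.sub hinv).max
      (tendsto_const_nhds.add (tendsto_const_nhds.sub (h.const_mul _)).sqrt)
  have hL1 : ∀ᶠ L : ℕ in Filter.atTop, 1 / |u| < (L : ℝ) :=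
    tendsto_natCast_atTop_atTop.eventually_gt_atTop _
  have hfl : ∀ ρ : ℝ, 0 < ρ → ∀ᶠ L : ℕ in Filter.atTop, 1 ≤ ⌊ρ * L⌋₊ := by
    intro ρ h
    filter_upwards [(tendsto_natCast_atTop_atTop (R := ℝ)).eventually_ge_atTop (1 / ρ)] with L hL
    rw [Nat.le_floor_iff (by positivity)]
    rw [div_le_iff₀ h] at hL
    push_cast
    linarith
  constructor
  · rintro ρ ⟨h0, h2⟩
    have key := ((((ha ρ h0).sub hinv).const_mul (u / 2)).add
      (((ha ρ h0).div_const 2).mul hinv)).sub (((hM ρ _ (ha ρ h0)).div_const 2).mul hinv)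
    have e : u / 2 * (ρ - 0) + ρ / 2 * 0
      - max (2 - 0) (1 + Real.sqrt ((u + 1) ^ 2 - 2 * u * ρ)) / 2 * 0 = u * ρ / 2 := by ring
    rw [e] at key
    refine key.congr' ?_
    filter_upwards [hL1, hfl ρ h0, Filter.eventually_gt_atTop 0] with L hL hf hp
    have hp' : (0 : ℝ) < L := by exact_mod_cast hp
    rw [hE L _ hL hf (Nat.floor_le_of_le (by push_cast; nlinarith)), mul_div_assoc (2 * u)]
    field_simp
  · rintro ρ ⟨h0, h2⟩
    have ha' : Filter.Tendsto (fun L : ℕ => (⌊ρ * L⌋₊ : ℝ) / L + 1 / L)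
      Filter.atTop (nhds ρ) := by simpa using (ha ρ h0).add hinv
    have key := ((hinv.div_const 2).const_add (u / 2)).sub
      (((hM ρ _ ha').sub (hM ρ _ (ha ρ h0))).div_const 2)
    simp only [sub_self, zero_div, add_zero, sub_zero] at key
    refine key.congr' ?_
    filter_upwards [hL1, hfl ρ h0, Filter.eventually_gt_atTop 0] with L hL hf hp
    have hp' : (0 : ℝ) < L := by exact_mod_cast hp
    have hlt : ⌊ρ * L⌋₊ < 2 * L := by
      rw [Nat.floor_lt (by positivity)]
      push_cast
      nlinarith
    rw [hE L _ hL hf hlt.le, hE L _ hL (by omega) hlt, mul_div_assoc (2 * u),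
      mul_div_assoc (2 * u)]
    push_cast
    rw [← add_div (⌊ρ * L⌋₊ : ℝ) 1 (L : ℝ)]
    generalize max (2 - 1 / (L : ℝ)) _ = A
    generalize max (2 - 1 / (L : ℝ)) _ = B
    field_simp
    ring
end

section
/- Let N, M ≥ 1 be integers, L = N + M, and let u be real. Let n, m be integers with 0 ≤ n ≤ N, 0 ≤ m ≤ M, n + m ≥ 2 and n + m ≤ L − 2. Let H be the L×L real symmetric matrix indexed by the disjoint union of A = {1,…,N} and B = {1,…,M}, with entries: H_{xy} = −1/L whenever x and y lie in different parts, H_{xy} = 0 whenever x ≠ y lie in the same part, and diagonal entries u on the first n indices of A and the first m indices of B and 0 on the remaining diagonal entries. Then for every real λ, det(H − λ·I) = (u − λ)^{n+m−2} · (−λ)^{L−n−m−2} · S(λ), where S(λ) = λ²(u − λ)² − ((N/L)λ − ((N−n)/L)u) · ((M/L)λ − ((M−m)/L)u). In particular the spectrum of H consists of 0 with multiplicity L−n−m−2, u with multiplicity n+m−2, and the four roots of the quartic S. -/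
theorem fk_det_aux {N M : ℕ} (a : Fin N → ℝ) (b : Fin M → ℝ) (c : ℝ)
    (ha : ∀ i, a i ≠ 0) (hb : ∀ i, b i ≠ 0) :
    (Matrix.fromBlocks (Matrix.diagonal a) (Matrix.of fun (_ : Fin N) (_ : Fin M) => c)
      (Matrix.of fun (_ : Fin M) (_ : Fin N) => c) (Matrix.diagonal b)).det
    = (∏ i, a i) * (∏ j, b j) * (1 - c ^ 2 * (∑ i, (a i)⁻¹) * (∑ j, (b j)⁻¹)) := by
  have hA : Matrix.diagonal a * Matrix.diagonal (fun i => (a i)⁻¹) = 1 := by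
    rw [Matrix.diagonal_mul_diagonal, ← Matrix.diagonal_one]
    congr 1; funext i; exact mul_inv_cancel₀ (ha i)
  let _ : Invertible (Matrix.diagonal a) := ⟨_, mul_eq_one_comm.1 hA, hA⟩
  have hinv : ⅟ (Matrix.diagonal a) = Matrix.diagonal (fun i => (a i)⁻¹) := invOf_eq_right_inv hA
  rw [Matrix.det_fromBlocks₁₁, hinv, Matrix.det_diagonal, mul_assoc]
  congr 1
  have hfac : Matrix.diagonal b - (Matrix.of fun (_ : Fin M) (_ : Fin N) => c) *
      Matrix.diagonal (fun i => (a i)⁻¹) * (Matrix.of fun (_ : Fin N) (_ : Fin M) => c)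
      = Matrix.diagonal b * (1 + Matrix.replicateCol Unit (fun j => (b j)⁻¹) *
        Matrix.replicateRow Unit (fun _ => - (c ^ 2 * ∑ i, (a i)⁻¹))) := by
    ext i j
    have h1 : ((Matrix.of fun (_ : Fin M) (_ : Fin N) => c) *
      Matrix.diagonal (fun i => (a i)⁻¹) * (Matrix.of fun (_ : Fin N) (_ : Fin M) => c)) i j
       = c ^ 2 * ∑ i, (a i)⁻¹ := by
      rw [Matrix.mul_apply, Finset.mul_sum]
      refine Finset.sum_congr rfl fun k _ => ?_
      rw [Matrix.mul_diagonal]; simp only [Matrix.of_apply]; ring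
    have h2 := hb i
    rw [Matrix.sub_apply, h1, Matrix.diagonal_mul, Matrix.add_apply, Matrix.mul_apply]
    by_cases hij : i = j
    · subst hij
      simp
      field_simp
      ring
    · simp [hij]
      field_simp
  rw [hfac, Matrix.det_mul, Matrix.det_diagonal, Matrix.det_one_add_replicateCol_mul_replicateRow]
  congr 1
  simp only [dotProduct, neg_mul, Finset.sum_neg_distrib, ← Finset.mul_sum]
  ring

theorem fk_sum_aux (N n : ℕ) (hn : n ≤ N) (x y : ℝ) :
    (∑ i : Fin N, if (i : ℕ) < n then x else y) = n * x + ((N : ℝ) - n) * y := by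
  rw [Fin.sum_univ_eq_sum_range (fun i => if i < n then x else y) N]
  obtain ⟨k, rfl⟩ := Nat.exists_eq_add_of_le hn
  rw [Finset.sum_range_add, Finset.sum_congr rfl (g := fun _ => x)]
  · simp
  · intro i hi; simp [Finset.mem_range.1 hi]

theorem fk_prod_aux (N n : ℕ) (hn : n ≤ N) (x y : ℝ) :
    (∏ i : Fin N, if (i : ℕ) < n then x else y) = x ^ n * y ^ (N - n) := by
  rw [Fin.prod_univ_eq_prod_range (fun i => if i < n then x else y) N]
  obtain ⟨k, rfl⟩ := Nat.exists_eq_add_of_le hn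
  rw [Finset.prod_range_add, Finset.prod_congr rfl (g := fun _ => x)]
  · simp
  · intro i hi; simp [Finset.mem_range.1 hi]

/-- Characteristic determinant of the bipartite mean-field
Falicov–Kimball Hamiltonian with sublattices of sizes `N`, `M` (`L = N + M`),
hopping `−1/L` between the sublattices, and `n` (resp. `m`) nuclei on the
first sites of each sublattice:
`det(H − λI) = (u−λ)^{n+m−2}·(−λ)^{L−n−m−2}·S(λ)` with
`S(λ) = λ²(u−λ)² − ((N/L)λ − ((N−n)/L)u)((M/L)λ − ((M−m)/L)u)`. -/
theorem stmt16 (N M : ℕ) (hN : 1 ≤ N) (hM : 1 ≤ M) (u : ℝ)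
    (n m : ℕ) (hn : n ≤ N) (hm : m ≤ M)
    (hnm2 : 2 ≤ n + m) (hnmL : n + m ≤ N + M - 2) (lam : ℝ) :
    (Matrix.fromBlocks
        (Matrix.diagonal fun x : Fin N => if (x : ℕ) < n then u else 0)
        (Matrix.of fun (_ : Fin N) (_ : Fin M) => (-1 / ((N : ℝ) + M)))
        (Matrix.of fun (_ : Fin M) (_ : Fin N) => (-1 / ((N : ℝ) + M)))
        (Matrix.diagonal fun y : Fin M => if (y : ℕ) < m then u else 0)
      - lam • (1 : Matrix (Fin N ⊕ Fin M) (Fin N ⊕ Fin M) ℝ)).det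
    = (u - lam) ^ (n + m - 2) * (-lam) ^ (N + M - (n + m) - 2) *
      (lam ^ 2 * (u - lam) ^ 2
        - (((N : ℝ) / ((N : ℝ) + M)) * lam - (((N : ℝ) - n) / ((N : ℝ) + M)) * u)
          * (((M : ℝ) / ((N : ℝ) + M)) * lam - (((M : ℝ) - m) / ((N : ℝ) + M)) * u)) := by
  revert lam
  rw [← funext_iff]
  have hd : Dense (({0, u} : Set ℝ)ᶜ) :=
    (Set.toFinite ({0, u} : Set ℝ)).countable.dense_compl ℝ
  refine Continuous.ext_on hd ?_ ?_ ?_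
  · refine Continuous.matrix_det ?_
    fun_prop
  · fun_prop
  intro lam hlam
  simp only [Set.mem_compl_iff, Set.mem_insert_iff, Set.mem_singleton_iff, not_or] at hlam
  obtain ⟨h0, hu⟩ := hlam
  have hu' : u - lam ≠ 0 := sub_ne_zero.2 (Ne.symm hu)
  have hl' : -lam ≠ 0 := neg_ne_zero.2 h0
  have hmat : (Matrix.fromBlocks
        (Matrix.diagonal fun x : Fin N => if (x : ℕ) < n then u else 0)
        (Matrix.of fun (_ : Fin N) (_ : Fin M) => (-1 / ((N : ℝ) + M)))
        (Matrix.of fun (_ : Fin M) (_ : Fin N) => (-1 / ((N : ℝ) + M)))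
        (Matrix.diagonal fun y : Fin M => if (y : ℕ) < m then u else 0)
      - lam • (1 : Matrix (Fin N ⊕ Fin M) (Fin N ⊕ Fin M) ℝ)) =
      Matrix.fromBlocks
        (Matrix.diagonal fun x : Fin N => if (x : ℕ) < n then u - lam else -lam)
        (Matrix.of fun (_ : Fin N) (_ : Fin M) => (-1 / ((N : ℝ) + M)))
        (Matrix.of fun (_ : Fin M) (_ : Fin N) => (-1 / ((N : ℝ) + M)))
        (Matrix.diagonal fun y : Fin M => if (y : ℕ) < m then u - lam else -lam) := by
    ext i j
    rcases i with i | i <;> rcases j with j | j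
    · by_cases h : i = j
      · subst h
        by_cases h2 : (i : ℕ) < n <;> simp [h2]
      · simp [h, Matrix.one_apply]
    · simp
    · simp
    · by_cases h : i = j
      · subst h
        by_cases h2 : (i : ℕ) < m <;> simp [h2]
      · simp [h, Matrix.one_apply]
  have hL : ((N : ℝ) + M) ≠ 0 := by positivity
  simp only []
  rw [hmat, fk_det_aux _ _ _ (fun i => by split_ifs <;> assumption)
    (fun i => by split_ifs <;> assumption), fk_prod_aux N n hn, fk_prod_aux M m hm]
  simp only [apply_ite (fun z : ℝ => z⁻¹)]
  rw [fk_sum_aux N n hn, fk_sum_aux M m hm]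
  have e1 : (u - lam) ^ n * (-lam) ^ (N - n) * ((u - lam) ^ m * (-lam) ^ (M - m))
      = (u - lam) ^ (n + m - 2) * (-lam) ^ (N + M - (n + m) - 2) *
        ((u - lam) ^ 2 * (-lam) ^ 2) := by
    have a1 : (u - lam) ^ n * (u - lam) ^ m = (u - lam) ^ (n + m - 2) * (u - lam) ^ 2 := by
      rw [← pow_add, ← pow_add]; congr 1; omega
    have a2 : (-lam) ^ (N - n) * (-lam) ^ (M - m)
        = (-lam) ^ (N + M - (n + m) - 2) * (-lam) ^ 2 := by
      rw [← pow_add, ← pow_add]; congr 1; omega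
    linear_combination ((-lam) ^ (N - n) * (-lam) ^ (M - m)) * a1
      + (u - lam) ^ (n + m - 2) * (u - lam) ^ 2 * a2
  rw [e1, mul_assoc]
  congr 1
  rw [inv_neg]
  field_simp
  ring
end

section
/- Let u ≠ 0 be real and for ρ ∈ [0, 1/2] define Θ±(ρ) = √( u² + 2ρ(1−ρ) ± 2√( ρ²(1−ρ)² + u²ρ(1−ρ) ) ). Then both radicands are nonnegative on [0,1/2], Θ₊ is monotone nondecreasing on [0, 1/2], and Θ₋ is monotone nonincreasing on [0, 1/2]; moreover Θ±(0) = |u|. -/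
theorem aux18 (u x : ℝ) (h : 0 ≤ x) :
    2 * Real.sqrt (x ^ 2 + u ^ 2 * x) ≤ u ^ 2 + 2 * x ∧
    ∀ y, x ≤ y → Real.sqrt (x ^ 2 + u ^ 2 * x) + (y - x) ≤ Real.sqrt (y ^ 2 + u ^ 2 * y) := by
  have hs : Real.sqrt (x ^ 2 + u ^ 2 * x) ^ 2 = x ^ 2 + u ^ 2 * x :=
    Real.sq_sqrt (by positivity)
  have h1 : 2 * Real.sqrt (x ^ 2 + u ^ 2 * x) ≤ u ^ 2 + 2 * x := by
    refine abs_le_of_sq_le_sq' ?_ (by positivity) |>.2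
    nlinarith [sq_nonneg (u ^ 2)]
  refine ⟨h1, fun y hy => Real.le_sqrt_of_sq_le ?_⟩
  nlinarith [mul_le_mul_of_nonneg_right h1 (sub_nonneg.2 hy)]


/-- For real `u ≠ 0` and
`Θ±(ρ) = √(u² + 2ρ(1−ρ) ± 2√(ρ²(1−ρ)² + u²ρ(1−ρ)))` on `ρ ∈ [0, 1/2]`:
both radicands are nonnegative, `Θ₊` is monotone nondecreasing, `Θ₋` is
monotone nonincreasing, and `Θ±(0) = |u|`. -/
theorem stmt18 (u : ℝ) (hu : u ≠ 0)
    (Θp Θm : ℝ → ℝ)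
    (hΘp : ∀ ρ, Θp ρ = Real.sqrt (u ^ 2 + 2 * ρ * (1 - ρ)
      + 2 * Real.sqrt (ρ ^ 2 * (1 - ρ) ^ 2 + u ^ 2 * ρ * (1 - ρ))))
    (hΘm : ∀ ρ, Θm ρ = Real.sqrt (u ^ 2 + 2 * ρ * (1 - ρ)
      - 2 * Real.sqrt (ρ ^ 2 * (1 - ρ) ^ 2 + u ^ 2 * ρ * (1 - ρ)))) :
    (∀ ρ ∈ Set.Icc (0 : ℝ) (1 / 2),
      0 ≤ ρ ^ 2 * (1 - ρ) ^ 2 + u ^ 2 * ρ * (1 - ρ) ∧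
      0 ≤ u ^ 2 + 2 * ρ * (1 - ρ)
        + 2 * Real.sqrt (ρ ^ 2 * (1 - ρ) ^ 2 + u ^ 2 * ρ * (1 - ρ)) ∧
      0 ≤ u ^ 2 + 2 * ρ * (1 - ρ)
        - 2 * Real.sqrt (ρ ^ 2 * (1 - ρ) ^ 2 + u ^ 2 * ρ * (1 - ρ))) ∧
    MonotoneOn Θp (Set.Icc (0 : ℝ) (1 / 2)) ∧
    AntitoneOn Θm (Set.Icc (0 : ℝ) (1 / 2)) ∧
    Θp 0 = |u| ∧ Θm 0 = |u| := by
  have hx : ∀ ρ ∈ Set.Icc (0 : ℝ) (1 / 2), 0 ≤ ρ * (1 - ρ) := by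
    rintro ρ ⟨h0, h1⟩
    exact mul_nonneg h0 (by linarith)
  have e : ∀ ρ : ℝ, ρ ^ 2 * (1 - ρ) ^ 2 + u ^ 2 * ρ * (1 - ρ)
      = (ρ * (1 - ρ)) ^ 2 + u ^ 2 * (ρ * (1 - ρ)) := fun ρ => by ring
  have key := aux18 u
  refine ⟨?_, ?_, ?_, ?_, ?_⟩
  · intro ρ hρ
    have h := hx ρ hρ
    have k := (key _ h).1
    rw [e]
    have s0 := Real.sqrt_nonneg ((ρ * (1 - ρ)) ^ 2 + u ^ 2 * (ρ * (1 - ρ)))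
    refine ⟨by positivity, by nlinarith [sq_nonneg u], by linarith⟩
  · intro a ha b hb hab
    rw [hΘp, hΘp, e, e]
    have h := hx a ha
    have hd : a * (1 - a) ≤ b * (1 - b) := by nlinarith [ha.1, ha.2, hb.1, hb.2]
    have k := (key _ h).2 _ hd
    exact Real.sqrt_le_sqrt (by linarith)
  · intro a ha b hb hab
    rw [hΘm, hΘm, e, e]
    have h := hx a ha
    have hd : a * (1 - a) ≤ b * (1 - b) := by nlinarith [ha.1, ha.2, hb.1, hb.2]
    have k := (key _ h).2 _ hd
    exact Real.sqrt_le_sqrt (by linarith)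
  · rw [hΘp]; simp [Real.sqrt_sq_eq_abs]
  · rw [hΘm]; simp [Real.sqrt_sq_eq_abs]
end

section
/- Let N, M ≥ 1 be integers, L = N + M, and let U be real. Let T be the L×L real symmetric matrix with entries 1/L between indices lying in different parts of a partition into sets of sizes N and M, and 0 otherwise (including the diagonal and within each part). Then T² + U²·I is positive semidefinite, and its (unique) positive semidefinite square root has trace Tr (T² + U²·I)^{1/2} = (L − 2)|U| + 2√(U² + NM/L²). -/
/-- For the bipartite mean-field hopping matrix `T` (entries
`1/L` between the two sublattices of sizes `N` and `M`, `L = N + M`, and `0`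
otherwise) and real `U`, the matrix `T² + U²·I` is positive semidefinite and
its unique positive semidefinite square root has trace
`(L − 2)|U| + 2√(U² + NM/L²)`. -/
theorem stmt19 (N M : ℕ) (hN : 1 ≤ N) (hM : 1 ≤ M) (U : ℝ)
    (T : Matrix (Fin N ⊕ Fin M) (Fin N ⊕ Fin M) ℝ)
    (hT : T = Matrix.fromBlocks 0
      (Matrix.of fun (_ : Fin N) (_ : Fin M) => (1 / ((N : ℝ) + M)))
      (Matrix.of fun (_ : Fin M) (_ : Fin N) => (1 / ((N : ℝ) + M))) 0) :
    (T ^ 2 + U ^ 2 • (1 : Matrix (Fin N ⊕ Fin M) (Fin N ⊕ Fin M) ℝ)).PosSemidef ∧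
    ∃ S : Matrix (Fin N ⊕ Fin M) (Fin N ⊕ Fin M) ℝ,
      S.PosSemidef ∧
      S ^ 2 = T ^ 2 + U ^ 2 • (1 : Matrix (Fin N ⊕ Fin M) (Fin N ⊕ Fin M) ℝ) ∧
      (∀ S' : Matrix (Fin N ⊕ Fin M) (Fin N ⊕ Fin M) ℝ,
        S'.PosSemidef →
        S' ^ 2 = T ^ 2 + U ^ 2 • (1 : Matrix (Fin N ⊕ Fin M) (Fin N ⊕ Fin M) ℝ) →
        S' = S) ∧
      S.trace = ((N : ℝ) + M - 2) * |U|
        + 2 * Real.sqrt (U ^ 2 + ((N : ℝ) * M) / ((N : ℝ) + M) ^ 2) := by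
  have hL : (0:ℝ) < (N : ℝ) + M := by positivity
  have hN' : (0:ℝ) < N := by exact_mod_cast hN
  have hM' : (0:ℝ) < M := by exact_mod_cast hM
  obtain ⟨l, hl⟩ : ∃ l : ℝ, l = ((N : ℝ) * M) / ((N : ℝ) + M) ^ 2 := ⟨_, rfl⟩
  have hl0 : 0 < l := by rw [hl]; positivity
  have hsym : T.conjTranspose = T := by
    rw [hT, Matrix.fromBlocks_conjTranspose]
    congr 1 <;> ext i j <;> simp
  obtain ⟨A, hA⟩ : ∃ A, A = T ^ 2 := ⟨_, rfl⟩
  have hA1 : A = Matrix.fromBlocks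
      (Matrix.of fun (_ : Fin N) (_ : Fin N) => (M : ℝ) / ((N : ℝ) + M) ^ 2) 0 0
      (Matrix.of fun (_ : Fin M) (_ : Fin M) => (N : ℝ) / ((N : ℝ) + M) ^ 2) := by
    rw [hA, hT, sq, Matrix.fromBlocks_multiply]
    congr 1 <;> ext i j <;> simp [Matrix.mul_apply] <;> field_simp
  have hAA : A * A = l • A := by
    rw [hA1, Matrix.fromBlocks_multiply, Matrix.fromBlocks_smul, hl]
    congr 1 <;> ext i j <;> simp [Matrix.mul_apply] <;> field_simp
  have htr : A.trace = 2 * l := by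
    rw [hA1, hl]
    simp [Matrix.trace]
    field_simp
    ring
  have hAp : A.PosSemidef := by
    have := Matrix.posSemidef_conjTranspose_mul_self T
    rwa [hsym, ← sq, ← hA] at this
  rw [← hA, ← hl]
  obtain ⟨s, hs⟩ : ∃ s, s = Real.sqrt (U ^ 2 + l) := ⟨_, rfl⟩
  have hs2 : s ^ 2 = U ^ 2 + l := by rw [hs]; exact Real.sq_sqrt (by positivity)
  have hsU : |U| ≤ s := by rw [hs]; exact Real.abs_le_sqrt (by linarith)
  rw [← hs]
  have h1 : (1 : Matrix (Fin N ⊕ Fin M) (Fin N ⊕ Fin M) ℝ).PosSemidef := Matrix.PosSemidef.one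
  have hSp : (|U| • (1 : Matrix (Fin N ⊕ Fin M) (Fin N ⊕ Fin M) ℝ)
      + ((s - |U|) / l) • A).PosSemidef :=
    (h1.smul (abs_nonneg U)).add (hAp.smul (div_nonneg (by linarith) hl0.le))
  have hS2 : (|U| • (1 : Matrix (Fin N ⊕ Fin M) (Fin N ⊕ Fin M) ℝ)
      + ((s - |U|) / l) • A) ^ 2 = A + U ^ 2 • 1 := by
    have e : 2 * (|U| * ((s - |U|) / l)) + ((s - |U|) / l) ^ 2 * l = 1 := by
      field_simp
      nlinarith [sq_abs U]
    have : (|U| • (1 : Matrix (Fin N ⊕ Fin M) (Fin N ⊕ Fin M) ℝ)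
      + ((s - |U|) / l) • A) ^ 2 = (|U| ^ 2) • 1 +
        (2 * (|U| * ((s - |U|) / l)) + ((s - |U|) / l) ^ 2 * l) • A := by
      rw [sq]
      simp only [add_mul, mul_add, smul_mul_assoc, mul_smul_comm, hAA, one_mul, mul_one, smul_smul]
      module
    rw [this, e, sq_abs, one_smul, add_comm]
  refine ⟨hAp.add (h1.smul (sq_nonneg U)), _, hSp, hS2, ?_, ?_⟩
  · intro S' hS' h
    rw [← hS2] at h
    open scoped MatrixOrder Matrix.Norms.L2Operator in
    exact (CFC.sq_eq_sq_iff S' _ hS'.nonneg hSp.nonneg).1 h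
  · rw [Matrix.trace_add, Matrix.trace_smul, Matrix.trace_smul, htr, Matrix.trace_one]
    simp
    field_simp
    ring
end
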